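/- arXiv:2409.03590 — 3 statements merged into one kernel-verified Lean document; each statement's English description precedes it below -/
import Mathlib

section
/- For any holomorphic solution φ of the ODE D⁴φ − 108 z³ Dφ − 162 z³ φ = 0 on the universal cover of ℂ*, with ε = e^{2πi/3}, the identity φ(zε⁴) − 4φ(zε³) + 6φ(zε²) − 4φ(zε) + φ(z) = 0 holds. -/
open Complex

namespace LG24

/-- the step -/
noncomputable def L : ℝ := 2 * Real.pi / 3

/-- a jet sequence of a solution -/
structure Sol (f : ℕ → ℂ → ℂ) : Prop where
  d : ∀ j w, HasDerivAt (f j) (f (j+1) w) w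
  ode : ∀ w, f 4 w = Complex.exp (3 * w) * (108 * f 1 w + 162 * f 0 w)

/-- difference -/
noncomputable def Dl (f : ℕ → ℂ → ℂ) : ℕ → ℂ → ℂ := fun j w => f j (w + L * I) - f j w

lemma exp_per (w : ℂ) : Complex.exp (3 * (w + L * I)) = Complex.exp (3 * w) := by
  have : 3 * (w + L * I) = 3 * w + 2 * Real.pi * I := by
    simp only [L]; push_cast; ring
  rw [this, Complex.exp_periodic]

lemma Sol.dl {f : ℕ → ℂ → ℂ} (h : Sol f) : Sol (Dl f) where
  d j w := ((h.d j (w + L * I)).comp_add_const w (L * I)).sub (h.d j w)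
  ode w := by
    simp only [Dl]
    rw [h.ode, h.ode, exp_per]; ring

/-- bound on a vertical strip segment -/
def S (g : ℂ → ℂ) (x y : ℝ) (n : ℕ) (M : ℝ) : Prop :=
  ∀ t ∈ Set.Icc y (y + n * L), ‖g (x + t * I)‖ ≤ M

lemma L_pos : 0 < L := by unfold L; positivity
lemma L_le : L ≤ 3 := by unfold L; linarith [Real.pi_le_four]

lemma S.a {f : ℕ → ℂ → ℂ} {j : ℕ} {x y : ℝ} {n : ℕ} {M : ℝ} (h : S (f j) x y (n+1) M) :
    S (Dl f j) x y n (3 * M) := by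
  intro t ht
  have hL := L_pos
  have h1 := h t ⟨ht.1, by push_cast; linarith [ht.2]⟩
  have h2 := h (t + L) ⟨by linarith [ht.1], by push_cast; linarith [ht.2]⟩
  have e : (x : ℂ) + t * I + L * I = x + ((t + L : ℝ) : ℂ) * I := by push_cast; ring
  simp only [Dl]
  rw [e]
  have := norm_sub_le (f j (x + ((t + L : ℝ) : ℂ) * I)) (f j (x + t * I))
  have := norm_nonneg (f j (x + t * I))
  linarith

lemma S.b {f : ℕ → ℂ → ℂ} (hf : Sol f) {j : ℕ} {x y : ℝ} {n : ℕ} {M : ℝ}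
    (h : S (f (j+1)) x y (n+1) M) :
    S (Dl f j) x y n (3 * M) := by
  intro t ht
  have hL := L_pos
  have hM : 0 ≤ M := (norm_nonneg _).trans (h t ⟨ht.1, by push_cast; linarith [ht.2]⟩)
  have e : (x : ℂ) + t * I + L * I = x + ((t + L : ℝ) : ℂ) * I := by push_cast; ring
  simp only [Dl]
  rw [e]
  have key := norm_image_sub_le_of_norm_deriv_le_segment' (f := fun s : ℝ => f j (x + s * I))
    (f' := fun s : ℝ => f (j+1) (x + s * I) * I) (a := t) (b := t + L) (C := M) ?_ ?_ (t + L)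
    ⟨by linarith, le_rfl⟩
  · have : M * (t + L - t) ≤ 3 * M := by nlinarith [L_le]
    exact key.trans this
  · intro s _
    have h1 : HasDerivAt (fun z : ℂ => (x : ℂ) + z * I) I (s : ℂ) := by
      simpa using ((hasDerivAt_id (s : ℂ)).mul_const I).const_add (x : ℂ)
    exact ((hf.d j (x + s * I)).comp (s : ℂ) h1).comp_ofReal.hasDerivWithinAt
  · intro s hs
    rw [norm_mul, norm_I, mul_one]
    exact h s ⟨by linarith [ht.1, hs.1], by push_cast; linarith [ht.2, hs.2]⟩

/-- weighted jet -/
def V (f : ℕ → ℂ → ℂ) (w : ℂ) : ℂ × ℂ × ℂ × ℂ := (f 0 w, 2 * f 1 w, 4 * f 2 w, 8 * f 3 w)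
/-- its derivative -/
def V' (f : ℕ → ℂ → ℂ) (w : ℂ) : ℂ × ℂ × ℂ × ℂ := (f 1 w, 2 * f 2 w, 4 * f 3 w, 8 * f 4 w)

lemma V_le {f : ℕ → ℂ → ℂ} {w : ℂ} {M : ℝ} : ‖V f w‖ ≤ M ↔
    ‖f 0 w‖ ≤ M ∧ 2 * ‖f 1 w‖ ≤ M ∧ 4 * ‖f 2 w‖ ≤ M ∧ 8 * ‖f 3 w‖ ≤ M := by
  simp [V, Prod.norm_def]

lemma V'_le {f : ℕ → ℂ → ℂ} {w : ℂ} {M : ℝ} : ‖V' f w‖ ≤ M ↔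
    ‖f 1 w‖ ≤ M ∧ 2 * ‖f 2 w‖ ≤ M ∧ 4 * ‖f 3 w‖ ≤ M ∧ 8 * ‖f 4 w‖ ≤ M := by
  simp [V', Prod.norm_def]

lemma Sol.V_deriv {f : ℕ → ℂ → ℂ} (h : Sol f) (w : ℂ) : HasDerivAt (V f) (V' f w) w :=
  (h.d 0 w).prodMk (((h.d 1 w).const_mul 2).prodMk
    (((h.d 2 w).const_mul 4).prodMk ((h.d 3 w).const_mul 8)))

lemma Sol.f4 {f : ℕ → ℂ → ℂ} (h : Sol f) (x t : ℝ) :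
    ‖f 4 (x + t * I)‖ ≤ Real.exp (3 * x) * (216 * ‖V f (x + t * I)‖) := by
  obtain ⟨h0, h1, h2, h3⟩ := V_le.1 (le_refl ‖V f (x + t * I)‖)
  rw [h.ode, norm_mul, Complex.norm_exp]
  have : (3 * ((x : ℂ) + t * I)).re = 3 * x := by simp
  rw [this]
  gcongr
  refine (norm_add_le _ _).trans ?_
  rw [norm_mul, norm_mul]
  simp only [Complex.norm_ofNat]
  linarith

lemma exp9 : Real.exp (-9) ≤ 1 / 3456 := by
  have h : Real.exp (-9) = Real.exp (-1) ^ 9 := by rw [← Real.exp_nat_mul]; norm_num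
  rw [h]
  calc Real.exp (-1) ^ 9 ≤ (0.37 : ℝ) ^ 9 := by
        gcongr; linarith [Real.exp_neg_one_lt_d9]
    _ ≤ _ := by norm_num

lemma Sol.V'_bd {f : ℕ → ℂ → ℂ} (h : Sol f) (x t : ℝ) (hx : x ≤ -3) :
    ‖V' f (x + t * I)‖ ≤ 1 / 2 * ‖V f (x + t * I)‖ := by
  obtain ⟨h0, h1, h2, h3⟩ := V_le.1 (le_refl ‖V f (x + t * I)‖)
  have h4 := h.f4 x t
  have he : Real.exp (3 * x) ≤ 1 / 3456 :=
    (Real.exp_le_exp.2 (by linarith)).trans exp9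
  have := mul_le_mul_of_nonneg_right he (a := 216 * ‖V f (x + t * I)‖) (by positivity)
  refine V'_le.2 ⟨?_, ?_, ?_, ?_⟩ <;> linarith

lemma Sol.V_line {f : ℕ → ℂ → ℂ} (h : Sol f) (x t : ℝ) :
    HasDerivAt (fun x : ℝ => V f (x + t * I)) (V' f (x + t * I)) x := by
  have h1 : HasDerivAt (fun x : ℝ => (x : ℂ) + t * I) 1 x :=
    (Complex.ofRealCLM.hasDerivAt (x := x)).add_const _
  have h2 := (h.V_deriv (x + t * I)).scomp x h1
  rw [one_smul] at h2
  exact h2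

lemma gron {E : Type*} [NormedAddCommGroup E] [NormedSpace ℝ E] (g g' : ℝ → E) (a b : ℝ)
    (hab : a ≤ b) (hg : ∀ x, HasDerivAt g (g' x) x)
    (hb : ∀ x ∈ Set.Icc a b, ‖g' x‖ ≤ 1 / 2 * ‖g x‖) :
    ‖g b‖ ≤ ‖g a‖ * Real.exp (1 / 2 * (b - a)) := by
  have := norm_le_gronwallBound_of_norm_deriv_right_le (f := g) (f' := g') (δ := ‖g a‖)
    (K := 1 / 2) (ε := 0) (a := a) (b := b)
    (fun x _ => (hg x).continuousAt.continuousWithinAt)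
    (fun x _ => (hg x).hasDerivWithinAt) le_rfl
    (fun x hx => by simpa using hb x ⟨hx.1, hx.2.le⟩) b ⟨hab, le_rfl⟩
  rwa [gronwallBound_ε0] at this

lemma Sol.fwd {f : ℕ → ℂ → ℂ} (h : Sol f) (a b t : ℝ) (hab : a ≤ b) (hb : b ≤ -3) :
    ‖V f (b + t * I)‖ ≤ ‖V f (a + t * I)‖ * Real.exp (1 / 2 * (b - a)) :=
  gron (fun x : ℝ => V f (x + t * I)) (fun x : ℝ => V' f (x + t * I)) a b hab
    (fun x => h.V_line x t) (fun x hx => h.V'_bd x t (hx.2.trans hb))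

lemma Sol.bwd {f : ℕ → ℂ → ℂ} (h : Sol f) (a b t : ℝ) (hab : a ≤ b) (hb : b ≤ -3) :
    ‖V f (a + t * I)‖ ≤ ‖V f (b + t * I)‖ * Real.exp (1 / 2 * (b - a)) := by
  have := gron (fun x : ℝ => V f ((-x : ℝ) + t * I)) (fun x : ℝ => - V' f ((-x : ℝ) + t * I))
    (-b) (-a) (by linarith)
    (fun x => by
      have h2 := (h.V_line (-x) t).scomp x (hasDerivAt_neg x)
      rw [neg_one_smul] at h2
      exact h2)
    (fun x hx => by
      rw [norm_neg]; exact h.V'_bd (-x) t (by linarith [hx.1]))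
  simp only [neg_neg] at this
  convert this using 3
  ring

lemma Sol.zero {f : ℕ → ℂ → ℂ} (h : Sol f) (x y : ℝ) (hx : x ≤ -3) :
    Dl (Dl (Dl (Dl f))) 0 (x + y * I) = 0 := by
  have hcont : Continuous (fun t : ℝ => ‖V f ((-3 : ℝ) + t * I)‖) := by
    have : Continuous (V f) := continuous_iff_continuousAt.2 fun w => (h.V_deriv w).continuousAt
    fun_prop
  obtain ⟨K, hK⟩ := (isCompact_Icc (a := y) (b := y + (4 : ℕ) * L)).bddAbove_image
    hcont.continuousOn
  have hK' : ∀ t ∈ Set.Icc y (y + (4 : ℕ) * L), ‖V f ((-3 : ℝ) + t * I)‖ ≤ K :=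
    fun t ht => hK ⟨t, ht, rfl⟩
  have hL := L_pos
  have hK0 : 0 ≤ K := (norm_nonneg _).trans (hK' y ⟨le_rfl, by push_cast; linarith⟩)
  have h4 : ∀ x0 : ℝ, x0 ≤ -3 → S (f 4) x0 y 4 (216 * K * Real.exp (5 / 2 * x0)) := by
    intro x0 hx0 t ht
    have h1 := h.bwd x0 (-3) t hx0 le_rfl
    have h2 : Real.exp (1 / 2 * (-3 - x0)) ≤ Real.exp (-(1/2) * x0) :=
      Real.exp_le_exp.2 (by linarith)
    have h3 : ‖V f (x0 + t * I)‖ ≤ K * Real.exp (-(1/2) * x0) :=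
      h1.trans (mul_le_mul (hK' t ht) h2 (Real.exp_pos _).le hK0)
    calc _ ≤ _ := h.f4 x0 t
      _ ≤ Real.exp (3 * x0) * (216 * (K * Real.exp (-(1/2) * x0))) := by gcongr
      _ = 216 * K * (Real.exp (3 * x0) * Real.exp (-(1/2) * x0)) := by ring
      _ = _ := by rw [← Real.exp_add]; ring_nf
  set G := Dl (Dl (Dl (Dl f))) with hG
  have hGs : Sol G := h.dl.dl.dl.dl
  have hV : ∀ x0 : ℝ, x0 ≤ -3 → ‖V G (x0 + y * I)‖ ≤
      8 * 81 * 216 * K * Real.exp (5 / 2 * x0) := by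
    intro x0 hx0
    have s4 := h4 x0 hx0
    have s3 := S.b (n := 3) h s4
    have s2 := S.b (n := 2) h.dl s3
    have s1 := S.b (n := 1) h.dl.dl s2
    have r0 := S.b (n := 0) h.dl.dl.dl s1 y (by simp)
    have r1 := S.a (n := 0) s1 y (by simp)
    have r2 := S.a (n := 0) (S.a (n := 1) s2) y (by simp)
    have r3 := S.a (n := 0) (S.a (n := 1) (S.a (n := 2) s3)) y (by simp)
    have : 0 ≤ K * Real.exp (5 / 2 * x0) := by positivity
    refine V_le.2 ⟨?_, ?_, ?_, ?_⟩ <;> linarith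
  have hfin : ∀ x0 : ℝ, x0 ≤ x → ‖V G (x + y * I)‖ ≤
      8 * 81 * 216 * K * Real.exp (1 / 2 * x) * Real.exp (2 * x0) := by
    intro x0 hx0
    calc _ ≤ _ := hGs.fwd x0 x y hx0 hx
      _ ≤ 8 * 81 * 216 * K * Real.exp (5 / 2 * x0) * Real.exp (1 / 2 * (x - x0)) := by
        gcongr; exact hV x0 (hx0.trans hx)
      _ = 8 * 81 * 216 * K * (Real.exp (5 / 2 * x0) * Real.exp (1 / 2 * (x - x0))) := by ring
      _ = 8 * 81 * 216 * K * (Real.exp (1 / 2 * x) * Real.exp (2 * x0)) := by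
        rw [← Real.exp_add, ← Real.exp_add]; ring_nf
      _ = _ := by ring
  have hlim : Filter.Tendsto (fun x0 : ℝ => 8 * 81 * 216 * K * Real.exp (1 / 2 * x) *
      Real.exp (2 * x0)) Filter.atBot (nhds 0) := by
    have : Filter.Tendsto (fun x0 : ℝ => Real.exp (2 * x0)) Filter.atBot (nhds 0) :=
      Real.tendsto_exp_atBot.comp (Filter.tendsto_id.const_mul_atBot (by norm_num))
    simpa using this.const_mul (8 * 81 * 216 * K * Real.exp (1 / 2 * x))
  have hle : ‖V G (x + y * I)‖ ≤ 0 :=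
    ge_of_tendsto hlim ((Filter.eventually_le_atBot x).mono hfin)
  exact norm_le_zero_iff.1 (V_le.1 hle).1

end LG24

/-- Rotational identity for solutions of the quantum differential equation of `LG(2,4)`.
We model the universal cover of `ℂ*` by the exponential map `w ↦ z = e^w`, under which the
Euler operator `D = z d/dz` becomes `d/dw`.  If `ψ : ℂ → ℂ` is entire and satisfies
`ψ''''(w) − 108 e^{3w} ψ'(w) − 162 e^{3w} ψ(w) = 0` (i.e. `D⁴φ − 108z³Dφ − 162z³φ = 0`
for `φ` on the universal cover of `ℂ*`), then with `ε = e^{2πi/3}` (i.e. the shift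
`w ↦ w + 2πi/3` covering `z ↦ zε`) one has
`φ(zε⁴) − 4φ(zε³) + 6φ(zε²) − 4φ(zε) + φ(z) = 0`. -/
theorem LG24_rotation_identity
    (ψ : ℂ → ℂ) (hψ : Differentiable ℂ ψ)
    (hode : ∀ w : ℂ,
      iteratedDeriv 4 ψ w - 108 * Complex.exp (3 * w) * deriv ψ w
        - 162 * Complex.exp (3 * w) * ψ w = 0) :
    ∀ w : ℂ,
      ψ (w + 4 * (2 * Real.pi * Complex.I / 3))
        - 4 * ψ (w + 3 * (2 * Real.pi * Complex.I / 3))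
        + 6 * ψ (w + 2 * (2 * Real.pi * Complex.I / 3))
        - 4 * ψ (w + 2 * Real.pi * Complex.I / 3) + ψ w = 0 := by

  have hs : LG24.Sol (fun j => iteratedDeriv j ψ) := by
    constructor
    · intro j w
      have hd : Differentiable ℂ (iteratedDeriv j ψ) :=
        (hψ.contDiff (n := ⊤)).differentiable_iteratedDeriv j (by exact_mod_cast WithTop.coe_lt_top _)
      have := (hd w).hasDerivAt
      rwa [← iteratedDeriv_succ] at this
    · intro w
      have := hode w
      simp only [iteratedDeriv_one, iteratedDeriv_zero]
      linear_combination this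
  set G := LG24.Dl (LG24.Dl (LG24.Dl (LG24.Dl (fun j => iteratedDeriv j ψ)))) with hG
  have hGs : LG24.Sol G := hs.dl.dl.dl.dl
  have hGd : Differentiable ℂ (G 0) := fun w => (hGs.d 0 w).differentiableAt
  have han : AnalyticOnNhd ℂ (G 0) Set.univ := fun w _ => hGd.analyticAt w
  have hev : G 0 =ᶠ[nhds (-4 : ℂ)] 0 := by
    have : ∀ᶠ w : ℂ in nhds (-4 : ℂ), w.re < -3 :=
      (Complex.continuous_re.continuousAt).eventually_lt continuousAt_const (by norm_num)
    filter_upwards [this] with w hw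
    have := hs.zero w.re w.im hw.le
    rwa [Complex.re_add_im] at this
  have hz := han.eqOn_zero_of_preconnected_of_eventuallyEq_zero isPreconnected_univ
    (Set.mem_univ _) hev
  intro w
  have h := hz (Set.mem_univ w)
  simp only [hG, LG24.Dl, iteratedDeriv_zero, Pi.zero_apply] at h
  have hL : (LG24.L : ℂ) * I = 2 * Real.pi * I / 3 := by
    simp only [LG24.L]; push_cast; ring
  rw [hL] at h
  set c := 2 * Real.pi * I / 3 with hc
  have e2 : w + 2 * c = w + c + c := by ring
  have e3 : w + 3 * c = w + c + c + c := by ring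
  have e4 : w + 4 * c = w + c + c + c + c := by ring
  rw [e2, e3, e4]
  linear_combination h
end

section
/- The function φ₂(z) = ∫_Λ Γ(s)⁴ Γ(1/2 − s) 2^{−2s} z^{−3s} ds, where Λ is the vertical line Re s = κ with 0 < κ < 1/2 oriented upward, is holomorphic on the sector −5π/6 < arg z < 5π/6 and satisfies D⁴φ₂ − 108 z³ Dφ₂ − 162 z³ φ₂ = 0 there, where D = z d/dz. -/
open Complex MeasureTheory

lemma mb_integrable_exp_abs (δ : ℝ) (hδ : 0 < δ) :
    Integrable (fun t : ℝ => Real.exp (-δ * |t|)) := by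
  rw [← integrableOn_univ, ← Set.Iic_union_Ioi (a := (0:ℝ))]
  refine IntegrableOn.union ?_ ?_
  · refine (integrableOn_exp_mul_Iic hδ 0).congr_fun ?_ measurableSet_Iic
    intro x hx
    simp only [abs_of_nonpos (Set.mem_Iic.1 hx)]
    ring_nf
  · refine (integrableOn_exp_mul_Ioi (neg_lt_zero.2 hδ) 0).congr_fun ?_ measurableSet_Ioi
    intro x hx
    simp only [abs_of_pos (Set.mem_Ioi.1 hx)]

lemma mb_shift (f : ℂ → ℂ) (a b C δ : ℝ) (hδ : 0 < δ)
    (hf : ∀ w : ℂ, w.re ∈ Set.uIcc a b → DifferentiableAt ℂ f w)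
    (hb : ∀ w : ℂ, w.re ∈ Set.uIcc a b → ‖f w‖ ≤ C * Real.exp (-δ * |w.im|)) :
    ∫ t : ℝ, f (a + t * I) = ∫ t : ℝ, f (b + t * I) := by
  have hint : ∀ c ∈ Set.uIcc a b, Integrable (fun t : ℝ => f (c + t * I)) := by
    intro c hc
    refine Integrable.mono' ((mb_integrable_exp_abs δ hδ).const_mul C) ?_ ?_
    · apply Continuous.aestronglyMeasurable
      rw [continuous_iff_continuousAt]
      intro t
      have h1 : ContinuousAt f (c + t * I) := (hf _ (by simpa using hc)).continuousAt
      exact ContinuousAt.comp (f := fun t : ℝ => (c + t * I : ℂ)) h1 (by fun_prop)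
    · filter_upwards with t
      simpa using hb (c + t * I) (by simpa using hc)
  have hlim : ∀ c ∈ Set.uIcc a b, Filter.Tendsto (fun T : ℝ => ∫ t in (-T)..T, f (c + t * I))
      Filter.atTop (nhds (∫ t : ℝ, f (c + t * I))) := fun c hc =>
    intervalIntegral_tendsto_integral (hint c hc) Filter.tendsto_neg_atTop_atBot Filter.tendsto_id
  have hexp : Filter.Tendsto (fun T : ℝ => C * Real.exp (-δ * |T|) * |b - a|)
      Filter.atTop (nhds 0) := by
    have : Filter.Tendsto (fun T : ℝ => Real.exp (-δ * |T|)) Filter.atTop (nhds 0) := by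
      apply Real.tendsto_exp_atBot.comp
      exact Filter.Tendsto.const_mul_atTop_of_neg (neg_lt_zero.2 hδ) Filter.tendsto_abs_atTop_atTop
    simpa using (this.const_mul C).mul_const (|b - a|)
  have hh : ∀ T : ℝ, ‖∫ x in a..b, f (x + T * I)‖ ≤ C * Real.exp (-δ * |T|) * |b - a| := by
    intro T
    apply intervalIntegral.norm_integral_le_of_norm_le_const
    intro x hx
    simpa using hb (x + T * I) (by simpa using Set.uIoc_subset_uIcc hx)
  have h1 : Filter.Tendsto (fun T : ℝ => ∫ x in a..b, f (x + T * I)) Filter.atTop (nhds 0) :=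
    squeeze_zero_norm hh hexp
  have h2 : Filter.Tendsto (fun T : ℝ => ∫ x in a..b, f (x + (-T : ℝ) * I)) Filter.atTop (nhds 0) :=
    squeeze_zero_norm (fun T => by simpa using hh (-T)) hexp
  have key := ((h2.sub h1).add ((hlim b (by simp)).const_smul I)).sub
    ((hlim a (by simp)).const_smul I)
  have hz : ∀ T : ℝ, ((∫ x in a..b, f (x + (-T : ℝ) * I)) - (∫ x in a..b, f (x + T * I)))
      + I • (∫ t in (-T)..T, f (b + t * I)) - I • (∫ t in (-T)..T, f (a + t * I)) = 0 := by
    intro T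
    have := integral_boundary_rect_eq_zero_of_differentiableOn f (a + (-T : ℝ) * I) (b + T * I) (by
      intro w hw
      apply DifferentiableAt.differentiableWithinAt
      apply hf
      have := hw.1
      simpa using this)
    simpa using this
  simp only [hz] at key
  have h0 := tendsto_nhds_unique key tendsto_const_nhds
  have : I * ((∫ t : ℝ, f (b + t * I)) - ∫ t : ℝ, f (a + t * I)) = 0 := by
    rw [← h0]; simp [smul_eq_mul]; ring
  have := (mul_eq_zero.1 this).resolve_left I_ne_zero
  exact (sub_eq_zero.1 this).symm

lemma mb_Gamma_integral (s : ℂ) (hs : 0 < s.re) :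
    Gamma s = ∫ x : ℝ, cexp (s * x - cexp x) := by
  have himg : Real.exp '' Set.univ = Set.Ioi 0 := by
    rw [Set.image_univ, Real.range_exp]
  rw [Gamma_eq_integral hs, GammaIntegral, ← himg,
    integral_image_eq_integral_abs_deriv_smul MeasurableSet.univ
      (fun x _ => (Real.hasDerivAt_exp x).hasDerivWithinAt) Real.exp_injective.injOn]
  rw [Measure.restrict_univ]
  congr 1
  ext x
  rw [abs_of_pos (Real.exp_pos x), Complex.real_smul]
  push_cast
  rw [cpow_def_of_ne_zero (Complex.exp_ne_zero _),
    Complex.log_exp (by simp [Real.pi_pos]) (by simpa using Real.pi_pos.le), ← Complex.exp_add,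
    ← Complex.exp_add]
  congr 1
  ring

lemma mb_real_ineq (a b σ c x : ℝ) (h1 : a ≤ σ) (h2 : σ ≤ b) (hc : 0 < c) :
    σ * x - c * Real.exp x ≤ 2 * b ^ 2 / c - a * |x| := by
  have hK : 0 ≤ 2 * b ^ 2 / c := by positivity
  rcases le_total x 0 with hx | hx
  · rw [abs_of_nonpos hx]
    have := mul_pos hc (Real.exp_pos x)
    nlinarith
  · rw [abs_of_nonneg hx]
    have := Real.quadratic_le_exp_of_nonneg hx
    have h3 : c * (x ^ 2 / 2) ≤ c * Real.exp x := by
      apply mul_le_mul_of_nonneg_left _ hc.le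
      linarith
    have h4 : 2 * b * x ≤ 2 * b ^ 2 / c + c * (x ^ 2 / 2) := by
      have : 2 * b ^ 2 / c + c * (x ^ 2 / 2) - 2 * b * x = (2 * b - c * x) ^ 2 / (2 * c) := by
        field_simp; ring
      have h5 : 0 ≤ (2 * b - c * x) ^ 2 / (2 * c) := by positivity
      linarith
    nlinarith

lemma mb_Gamma_bound_aux (a b θ : ℝ) (ha : 0 < a) (hθ : |θ| < Real.pi / 2) (s : ℂ)
    (h1 : a ≤ s.re) (h2 : s.re ≤ b) :
    ‖Gamma s‖ ≤ (Real.exp (2 * b ^ 2 / Real.cos θ) * ∫ x : ℝ, Real.exp (-a * |x|))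
      * Real.exp (-(θ * s.im)) := by
  have hθ' := abs_lt.1 hθ
  have hc : 0 < Real.cos θ := Real.cos_pos_of_mem_Ioo ⟨by linarith, hθ'.2⟩
  set F : ℂ → ℂ := fun w => cexp (s * (-I * w) - cexp (-I * w)) with hF
  have hnorm : ∀ w : ℂ, ‖F w‖ =
      Real.exp (s.im * w.re + (s.re * w.im - Real.cos w.re * Real.exp w.im)) := by
    intro w
    rw [hF, Complex.norm_exp]
    congr 1
    simp [Complex.exp_re]
    ring
  have hcos : ∀ w : ℂ, w.re ∈ Set.uIcc 0 (-θ) → Real.cos θ ≤ Real.cos w.re ∧ |w.re| ≤ |θ| := by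
    intro w hw
    have h3 : |w.re| ≤ |θ| := by
      have := Set.abs_sub_left_of_mem_uIcc hw
      simpa using this
    refine ⟨?_, h3⟩
    rw [← Real.cos_abs θ, ← Real.cos_abs w.re]
    exact Real.cos_le_cos_of_nonneg_of_le_pi (abs_nonneg _) (by linarith [Real.pi_pos]) h3
  have hbd : ∀ w : ℂ, w.re ∈ Set.uIcc 0 (-θ) → ‖F w‖ ≤
      Real.exp (s.im * w.re) * (Real.exp (2 * b ^ 2 / Real.cos θ) * Real.exp (-a * |w.im|)) := by
    intro w hw
    rw [hnorm, ← Real.exp_add, ← Real.exp_add, Real.exp_le_exp]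
    have := mb_real_ineq a b s.re (Real.cos θ) w.im h1 h2 hc
    have h4 := mul_le_mul_of_nonneg_right (hcos w hw).1 (Real.exp_pos w.im).le
    linarith
  have hsh := mb_shift F 0 (-θ) (Real.exp (|s.im| * |θ|) * Real.exp (2 * b ^ 2 / Real.cos θ)) a ha
    (fun w _ => by rw [hF]; fun_prop) (by
      intro w hw
      refine (hbd w hw).trans ?_
      rw [mul_assoc]
      refine mul_le_mul_of_nonneg_right (Real.exp_le_exp.2 ?_) (by positivity)
      calc s.im * w.re ≤ |s.im * w.re| := le_abs_self _
        _ = |s.im| * |w.re| := abs_mul _ _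
        _ ≤ _ := mul_le_mul_of_nonneg_left (hcos w hw).2 (abs_nonneg _))
  have hG : Gamma s = ∫ t : ℝ, F ((0:ℝ) + t * I) := by
    rw [mb_Gamma_integral s (by linarith)]
    congr 1
    ext x
    rw [hF]
    have : -I * (((0:ℝ):ℂ) + x * I) = x := by
      push_cast
      linear_combination (-(x:ℂ)) * I_mul_I
    simp only [this]
  rw [hG, hsh]
  have : ∀ᵐ t : ℝ, ‖F ((-θ : ℝ) + t * I)‖ ≤ (Real.exp (s.im * (-θ)) *
      Real.exp (2 * b ^ 2 / Real.cos θ)) * Real.exp (-a * |t|) := by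
    filter_upwards with t
    have := hbd ((-θ : ℝ) + t * I) (by simp)
    rw [mul_assoc]
    simpa using this
  refine (norm_integral_le_of_norm_le ((mb_integrable_exp_abs a ha).const_mul _) this).trans ?_
  rw [integral_const_mul]
  apply le_of_eq
  rw [show s.im * -θ = -(θ * s.im) by ring]
  ring

lemma mb_Gamma_bound (a b θ : ℝ) (ha : 0 < a) (hθ0 : 0 ≤ θ) (hθ : θ < Real.pi / 2) :
    ∃ C : ℝ, 0 ≤ C ∧ ∀ s : ℂ, a ≤ s.re → s.re ≤ b → ‖Gamma s‖ ≤ C * Real.exp (-θ * |s.im|) := by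
  refine ⟨Real.exp (2 * b ^ 2 / Real.cos θ) * ∫ x : ℝ, Real.exp (-a * |x|), ?_, fun s h1 h2 => ?_⟩
  · exact mul_nonneg (Real.exp_pos _).le (integral_nonneg fun x => (Real.exp_pos _).le)
  · rcases le_total 0 s.im with h | h
    · have := mb_Gamma_bound_aux a b θ ha (by rwa [abs_of_nonneg hθ0]) s h1 h2
      rwa [abs_of_nonneg h, neg_mul]
    · have := mb_Gamma_bound_aux a b (-θ) ha (by rwa [abs_neg, abs_of_nonneg hθ0]) s h1 h2
      rw [Real.cos_neg] at this
      rw [abs_of_nonpos h]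
      simpa using this

def MBDecay (g : ℝ → ℂ) : Prop :=
  Continuous g ∧ ∀ θ : ℝ, θ < 5 * Real.pi / 2 → ∃ C : ℝ, 0 ≤ C ∧
    ∀ t, ‖g t‖ ≤ C * Real.exp (-θ * |t|)

def MBmul (σ : ℝ) (g : ℝ → ℂ) : ℝ → ℂ := fun t => g t * (-(3 : ℂ) * (σ + t * I))

lemma MBDecay.mul {g : ℝ → ℂ} (hg : MBDecay g) (σ : ℝ) : MBDecay (MBmul σ g) := by
  refine ⟨by have := hg.1; unfold MBmul; fun_prop, fun θ hθ => ?_⟩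
  set δ := (5 * Real.pi / 2 - θ) / 2 with hδ
  have hδ0 : 0 < δ := by rw [hδ]; linarith
  obtain ⟨C, hC, h⟩ := hg.2 (θ + δ) (by rw [hδ]; linarith)
  refine ⟨C * (3 * (|σ| + 1 / δ)), by positivity, fun t => ?_⟩
  have h1 : ‖(-(3 : ℂ) * (σ + t * I))‖ ≤ 3 * (|σ| + |t|) := by
    rw [norm_mul]
    have : ‖(σ + t * I : ℂ)‖ ≤ |σ| + |t| := by
      refine (norm_add_le _ _).trans ?_
      simp
    simpa using this
  have h2 : |σ| + |t| ≤ (|σ| + 1 / δ) * Real.exp (δ * |t|) := by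
    have e1 : 1 ≤ Real.exp (δ * |t|) := Real.one_le_exp (by positivity)
    have e2 : δ * |t| ≤ Real.exp (δ * |t|) := by
      have := Real.add_one_le_exp (δ * |t|); linarith
    have e3 : |t| ≤ 1 / δ * Real.exp (δ * |t|) := by
      rw [div_mul_eq_mul_div, one_mul, le_div_iff₀ hδ0]; linarith
    nlinarith [abs_nonneg σ]
  calc ‖MBmul σ g t‖ = ‖g t‖ * ‖(-(3 : ℂ) * (σ + t * I))‖ := norm_mul _ _
    _ ≤ (C * Real.exp (-(θ + δ) * |t|)) * (3 * ((|σ| + 1 / δ) * Real.exp (δ * |t|))) := by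
        refine mul_le_mul (h t) (h1.trans ?_) (norm_nonneg _) (by positivity)
        linarith
    _ = C * (3 * (|σ| + 1 / δ)) * (Real.exp (-(θ + δ) * |t|) * Real.exp (δ * |t|)) := by ring
    _ = _ := by rw [← Real.exp_add]; ring_nf

def MBS : Set ℂ := {z | z ≠ 0 ∧ |Complex.arg z| < 5 * Real.pi / 6}

lemma MBS_slit {z : ℂ} (hz : z ∈ MBS) : z ∈ slitPlane := by
  rw [mem_slitPlane_iff_arg]
  refine ⟨fun h => ?_, hz.1⟩
  have := hz.2
  rw [h, abs_of_pos Real.pi_pos] at this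
  linarith [Real.pi_pos]

lemma MBS_open : IsOpen MBS := by
  rw [isOpen_iff_mem_nhds]
  intro z hz
  have h1 : ∀ᶠ w in nhds z, w ≠ 0 := isOpen_ne.mem_nhds hz.1
  have h2 : ∀ᶠ w in nhds z, |arg w| < 5 * Real.pi / 6 :=
    (continuousAt_arg (MBS_slit hz)).abs.eventually_lt continuousAt_const hz.2
  filter_upwards [h1, h2] with w a b using ⟨a, b⟩

lemma mb_cpow_bound (z w : ℂ) (α : ℝ) (hz : z ≠ 0) (hα : |arg z| ≤ α) :
    ‖z ^ w‖ ≤ ‖z‖ ^ w.re * Real.exp (α * |w.im|) := by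
  rw [norm_cpow_of_ne_zero hz, div_eq_mul_inv, ← Real.exp_neg]
  refine mul_le_mul_of_nonneg_left (Real.exp_le_exp.2 ?_) (by positivity)
  calc -(arg z * w.im) ≤ |arg z * w.im| := neg_le_abs _
    _ = |arg z| * |w.im| := abs_mul _ _
    _ ≤ _ := by gcongr

lemma mb_cont {g : ℝ → ℂ} (hg : MBDecay g) (σ : ℝ) (e : ℂ) {z : ℂ} (hz : z ≠ 0) :
    Continuous (fun t : ℝ => g t * z ^ (-(3 : ℂ) * (σ + t * I) + e)) := by
  have h := hg.1
  refine h.mul ?_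
  refine Continuous.const_cpow (by fun_prop) (Or.inl hz)

lemma mb_integrable {g : ℝ → ℂ} (hg : MBDecay g) (σ : ℝ) {z : ℂ} (hz : z ∈ MBS) :
    Integrable (fun t : ℝ => g t * z ^ (-(3 : ℂ) * (σ + t * I))) := by
  set δ := (5 * Real.pi / 2 - 3 * |arg z|) / 2 with hδ
  have hz2 := hz.2
  have hδ0 : 0 < δ := by rw [hδ]; linarith
  obtain ⟨C, hC, h⟩ := hg.2 (3 * |arg z| + δ) (by rw [hδ]; linarith)
  refine Integrable.mono' ((mb_integrable_exp_abs δ hδ0).const_mul (C * ‖z‖ ^ (-3 * σ))) ?_ ?_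
  · simpa using (mb_cont hg σ 0 hz.1).aestronglyMeasurable
  · filter_upwards with t
    have h1 := mb_cpow_bound z (-(3 : ℂ) * (σ + t * I)) _ hz.1 le_rfl
    have e1 : (-(3 : ℂ) * (σ + t * I)).re = -3 * σ := by simp
    have e2 : |(-(3 : ℂ) * (σ + t * I)).im| = 3 * |t| := by simp [abs_mul]
    rw [e1, e2] at h1
    rw [norm_mul]
    refine (mul_le_mul (h t) h1 (norm_nonneg _) (by positivity)).trans (le_of_eq ?_)
    calc _ = C * ‖z‖ ^ (-3 * σ) * (Real.exp (-(3 * |arg z| + δ) * |t|)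
          * Real.exp (|arg z| * (3 * |t|))) := by ring
      _ = _ := by rw [← Real.exp_add]; ring_nf

lemma mb_hasDeriv {g : ℝ → ℂ} (hg : MBDecay g) (σ : ℝ) {z : ℂ} (hz : z ∈ MBS) :
    HasDerivAt (fun z : ℂ => ∫ t : ℝ, g t * z ^ (-(3 : ℂ) * (σ + t * I)))
      (∫ t : ℝ, MBmul σ g t * z ^ (-(3 : ℂ) * (σ + t * I) + (-1))) z := by
  obtain ⟨α, hα1, hα2⟩ := exists_between hz.2
  set δ := (5 * Real.pi / 2 - 3 * α) / 2 with hδ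
  have hδ0 : 0 < δ := by rw [hδ]; linarith
  obtain ⟨C, hC, h⟩ := (hg.mul σ).2 (3 * α + δ) (by rw [hδ]; linarith)
  set M := ‖z‖ ^ (-3 * σ - 1) + 1 with hM
  have hs : {w : ℂ | w ∈ MBS ∧ |arg w| < α ∧ ‖w‖ ^ (-3 * σ - 1) < M} ∈ nhds z := by
    have h1 := MBS_open.mem_nhds hz
    have h2 : ∀ᶠ w in nhds z, |arg w| < α :=
      (continuousAt_arg (MBS_slit hz)).abs.eventually_lt continuousAt_const hα1
    have h3 : ∀ᶠ w in nhds z, ‖w‖ ^ (-3 * σ - 1) < M := by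
      refine ContinuousAt.eventually_lt (f := fun w : ℂ => ‖w‖ ^ (-3 * σ - 1)) (g := fun _ => M) ?_
        continuousAt_const (by rw [hM]; linarith)
      exact continuous_norm.continuousAt.rpow_const (Or.inl (norm_ne_zero_iff.2 hz.1))
    filter_upwards [h1, h2, h3] with w a b c using ⟨a, b, c⟩
  refine (hasDerivAt_integral_of_dominated_loc_of_deriv_le
    (F := fun (w : ℂ) (t : ℝ) => g t * w ^ (-(3 : ℂ) * (σ + t * I)))
    (F' := fun (w : ℂ) (t : ℝ) => MBmul σ g t * w ^ (-(3 : ℂ) * (σ + t * I) + (-1)))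
    (bound := fun t => (C * M) * Real.exp (-δ * |t|))
    hs ?_ (mb_integrable hg σ hz) ?_ ?_ ?_ ?_).2
  · filter_upwards [MBS_open.mem_nhds hz] with w hw
    simpa using (mb_cont hg σ 0 hw.1).aestronglyMeasurable
  · exact (mb_cont (hg.mul σ) σ (-1) hz.1).aestronglyMeasurable
  · filter_upwards with t w hw
    obtain ⟨hw1, hw2, hw3⟩ := hw
    have h1 := mb_cpow_bound w (-(3 : ℂ) * (σ + t * I) + (-1)) α hw1.1 hw2.le
    have e1 : (-(3 : ℂ) * (σ + t * I) + (-1)).re = -3 * σ - 1 := by simp; ring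
    have e2 : |(-(3 : ℂ) * (σ + t * I) + (-1)).im| = 3 * |t| := by simp [abs_mul]
    rw [e1, e2] at h1
    have h2 := h1.trans (mul_le_mul_of_nonneg_right hw3.le (Real.exp_pos _).le)
    rw [norm_mul]
    refine (mul_le_mul (h t) h2 (norm_nonneg _) (by positivity)).trans (le_of_eq ?_)
    calc _ = C * M * (Real.exp (-(3 * α + δ) * |t|)
          * Real.exp (α * (3 * |t|))) := by ring
      _ = _ := by rw [← Real.exp_add]; ring_nf
  · exact (mb_integrable_exp_abs δ hδ0).const_mul _
  · filter_upwards with t w hw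
    have := ((hasDerivAt_id w).cpow_const (c := -(3 : ℂ) * (σ + t * I)) (MBS_slit hw.1)).const_mul
      (g t)
    refine this.congr_deriv ?_
    simp only [MBmul, id]
    rw [sub_eq_add_neg]
    ring

lemma mb_D {g : ℝ → ℂ} (hg : MBDecay g) (σ : ℝ) {z : ℂ} (hz : z ∈ MBS) (f : ℂ → ℂ)
    (hf : Set.EqOn f (fun z : ℂ => ∫ t : ℝ, g t * z ^ (-(3 : ℂ) * (σ + t * I))) MBS) :
    z * deriv f z = ∫ t : ℝ, MBmul σ g t * z ^ (-(3 : ℂ) * (σ + t * I)) := by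
  have : f =ᶠ[nhds z] (fun z : ℂ => ∫ t : ℝ, g t * z ^ (-(3 : ℂ) * (σ + t * I))) := by
    filter_upwards [MBS_open.mem_nhds hz] with w hw using hf hw
  rw [this.deriv_eq, (mb_hasDeriv hg σ hz).deriv, ← integral_const_mul]
  congr 1
  ext t
  rw [cpow_add _ _ hz.1, cpow_neg_one]
  field_simp [hz.1]

lemma mb_strip (a b p : ℝ) (ha : 0 < a) (hb : b < p) (θ : ℝ) (hθ : θ < 5 * Real.pi / 2) :
    ∃ C : ℝ, 0 ≤ C ∧ ∀ s : ℂ, a ≤ s.re → s.re ≤ b →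
      ‖Gamma s ^ 4 * Gamma (p - s) * (2 : ℂ) ^ (-(2 : ℂ) * s)‖ ≤ C * Real.exp (-θ * |s.im|) := by
  set η := max θ 0 / 5 with hη
  have hη0 : 0 ≤ η := by positivity
  have hη1 : η < Real.pi / 2 := by
    have : max θ 0 < 5 * Real.pi / 2 := max_lt hθ (by positivity)
    rw [hη]; linarith
  have hη2 : θ ≤ 5 * η := by
    have := le_max_left θ 0
    rw [hη]; linarith
  obtain ⟨C1, hC1, h1⟩ := mb_Gamma_bound a b η ha hη0 hη1
  obtain ⟨C2, hC2, h2⟩ := mb_Gamma_bound (p - b) (p - a) η (by linarith) hη0 hη1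
  refine ⟨C1 ^ 4 * C2, by positivity, fun s hs1 hs2 => ?_⟩
  have e1 := h1 s hs1 hs2
  have e2 := h2 (p - s) (by simp; linarith) (by simp; linarith)
  have e3 : ‖(2 : ℂ) ^ (-(2 : ℂ) * s)‖ ≤ 1 := by
    have := norm_cpow_eq_rpow_re_of_pos (x := 2) (by norm_num) (-(2 : ℂ) * s)
    push_cast at this
    rw [this]
    apply Real.rpow_le_one_of_one_le_of_nonpos (by norm_num)
    simp; linarith
  have e4 : |((p:ℂ) - s).im| = |s.im| := by simp
  rw [e4] at e2
  rw [norm_mul, norm_mul, norm_pow]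
  calc _ ≤ (C1 * Real.exp (-η * |s.im|)) ^ 4 * (C2 * Real.exp (-η * |s.im|)) * 1 := by gcongr
    _ = C1 ^ 4 * C2 * Real.exp (-(5 * η) * |s.im|) := by
      rw [show -(5 * η) * |s.im| = 4 * (-η * |s.im|) + (-η * |s.im|) by ring, Real.exp_add,
        show (4:ℝ) * (-η * |s.im|) = (4:ℕ) * (-η * |s.im|) by norm_num, Real.exp_nat_mul]
      ring
    _ ≤ _ := by
      gcongr

lemma mb_diff (p : ℝ) (s : ℂ) (h0 : 0 < s.re) (h1 : s.re < p) :
    DifferentiableAt ℂ (fun s : ℂ => Gamma s ^ 4 * Gamma (p - s) * (2 : ℂ) ^ (-(2 : ℂ) * s)) s := by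
  have g1 : ∀ w : ℂ, 0 < w.re → DifferentiableAt ℂ Gamma w := by
    intro w hw
    apply differentiableAt_Gamma
    intro m hm
    rw [hm] at hw
    simp at hw
    linarith [(Nat.cast_nonneg m : (0:ℝ) ≤ m)]
  have d1 := g1 s h0
  have d2 : DifferentiableAt ℂ (fun s : ℂ => Gamma (p - s)) s :=
    DifferentiableAt.comp (g := Gamma) (f := fun s : ℂ => (p:ℂ) - s) s
      (g1 _ (by simpa using h1)) (by fun_prop)
  have d3 : DifferentiableAt ℂ (fun s : ℂ => (2 : ℂ) ^ (-(2 : ℂ) * s)) s :=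
    DifferentiableAt.const_cpow (by fun_prop) (Or.inl two_ne_zero)
  exact ((d1.pow 4).mul d2).mul d3

noncomputable def MBg (κ : ℝ) : ℝ → ℂ := fun t => (Complex.Gamma (κ + t * Complex.I)) ^ 4
        * Complex.Gamma (1 / 2 - (κ + t * Complex.I))
        * (2 : ℂ) ^ (-(2 : ℂ) * (κ + t * Complex.I)) * Complex.I

lemma MBg_decay (κ : ℝ) (hκ0 : 0 < κ) (hκ : κ < 1 / 2) : MBDecay (MBg κ) := by
  have hp : (((1 / 2 : ℝ)) : ℂ) = 1 / 2 := by push_cast; rfl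
  constructor
  · rw [continuous_iff_continuousAt]
    intro t
    have := (mb_diff (1 / 2) (κ + t * I) (by simpa using hκ0) (by simpa using hκ)).continuousAt
    rw [hp] at this
    have h2 := ContinuousAt.comp (f := fun t : ℝ => (κ + t * I : ℂ)) this (by fun_prop)
    exact h2.mul continuousAt_const
  · intro θ hθ
    obtain ⟨C, hC, h⟩ := mb_strip κ κ (1 / 2) hκ0 hκ θ hθ
    refine ⟨C, hC, fun t => ?_⟩
    have := h (κ + t * I) (by simp) (by simp)
    rw [hp] at this
    rw [MBg, norm_mul, norm_I, mul_one]
    simpa using this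

lemma mb_main_shift (κ : ℝ) (hκ0 : 0 < κ) (hκ : κ < 1 / 2) {z : ℂ} (hz : z ∈ MBS) :
    ∫ t : ℝ, (fun s : ℂ => Gamma s ^ 4 * Gamma ((3 / 2 : ℝ) - s) * (2 : ℂ) ^ (-(2 : ℂ) * s)
        * z ^ (-(3 : ℂ) * s)) (κ + t * I) =
    ∫ t : ℝ, (fun s : ℂ => Gamma s ^ 4 * Gamma ((3 / 2 : ℝ) - s) * (2 : ℂ) ^ (-(2 : ℂ) * s)
        * z ^ (-(3 : ℂ) * s)) ((κ + 1 : ℝ) + t * I) := by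
  set δ := (5 * Real.pi / 2 - 3 * |arg z|) / 2 with hδ
  have hz2 := hz.2
  have hδ0 : 0 < δ := by rw [hδ]; linarith
  obtain ⟨C, hC, h⟩ := mb_strip κ (κ + 1) (3 / 2) hκ0 (by linarith) (3 * |arg z| + δ)
    (by rw [hδ]; linarith)
  have hu : Set.uIcc κ (κ + 1) = Set.Icc κ (κ + 1) := Set.uIcc_of_le (by linarith)
  obtain ⟨M, hM⟩ := (isCompact_Icc (a := κ) (b := κ + 1)).exists_bound_of_continuousOn
    (f := fun x : ℝ => ‖z‖ ^ (-3 * x)) (by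
      apply Continuous.continuousOn
      exact Continuous.rpow continuous_const (by fun_prop)
        (fun _ => Or.inl (norm_ne_zero_iff.2 hz.1)))
  refine mb_shift (fun s : ℂ => Gamma s ^ 4 * Gamma ((3 / 2 : ℝ) - s) * (2 : ℂ) ^ (-(2 : ℂ) * s)
        * z ^ (-(3 : ℂ) * s)) κ (κ + 1) (C * M) δ hδ0 ?_ ?_
  · intro w hw
    rw [hu] at hw
    refine (mb_diff (3 / 2) w (by linarith [hw.1]) (by linarith [hw.2])).mul ?_
    exact DifferentiableAt.const_cpow (by fun_prop) (Or.inl hz.1)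
  · intro w hw
    rw [hu] at hw
    have h1 := mb_cpow_bound z (-(3 : ℂ) * w) _ hz.1 le_rfl
    have e1 : (-(3 : ℂ) * w).re = -3 * w.re := by simp
    have e2 : |(-(3 : ℂ) * w).im| = 3 * |w.im| := by simp [abs_mul]
    rw [e1, e2] at h1
    have h2 := h1.trans (mul_le_mul_of_nonneg_right ((le_abs_self _).trans (hM w.re hw))
      (Real.exp_pos _).le)
    rw [norm_mul]
    refine (mul_le_mul (h w hw.1 hw.2) h2 (norm_nonneg _) (by positivity)).trans (le_of_eq ?_)
    calc _ = C * M * (Real.exp (-(3 * |arg z| + δ) * |w.im|)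
          * Real.exp (|arg z| * (3 * |w.im|))) := by ring
      _ = _ := by rw [← Real.exp_add]; ring_nf

lemma mb_left (κ : ℝ) (hκ0 : 0 < κ) {z : ℂ} (hz : z ∈ MBS) (t : ℝ) :
    MBmul κ (MBmul κ (MBmul κ (MBmul κ (MBg κ)))) t * z ^ (-(3 : ℂ) * (κ + t * I)) =
    (324 * z ^ 3 * I) * (fun s : ℂ => Gamma s ^ 4 * Gamma ((3 / 2 : ℝ) - s) *
      (2 : ℂ) ^ (-(2 : ℂ) * s) * z ^ (-(3 : ℂ) * s)) ((κ + 1 : ℝ) + t * I) := by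
  have hs : (((κ + 1 : ℝ) : ℂ) + t * I) = (κ + t * I) + 1 := by push_cast; ring
  simp only [MBmul, MBg, hs]
  have hs0 : (κ + t * I : ℂ) ≠ 0 := by
    intro h
    have := congrArg Complex.re h
    simp at this
    linarith
  generalize (κ + t * I : ℂ) = s at hs0
  have hz0 := hz.1
  rw [Gamma_add_one s hs0, show ((3 / 2 : ℝ) : ℂ) - (s + 1) = 1 / 2 - s by push_cast; ring,
    show -(2 : ℂ) * (s + 1) = -2 * s + (-2) by ring, show -(3 : ℂ) * (s + 1) = -3 * s + (-3) by ring,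
    cpow_add _ _ two_ne_zero, cpow_add _ _ hz0]
  have e1 : (2 : ℂ) ^ (-2 : ℂ) = 1 / 4 := by
    rw [cpow_neg, show (2 : ℂ) = ((2 : ℕ) : ℂ) by norm_num, cpow_natCast]; norm_num
  have e2 : z ^ (-3 : ℂ) = (z ^ 3)⁻¹ := by
    rw [cpow_neg, show (3 : ℂ) = ((3 : ℕ) : ℂ) by norm_num, cpow_natCast]
  rw [e1, e2]
  field_simp
  ring

lemma mb_right (κ : ℝ) (hκ : κ < 1 / 2) {z : ℂ} (t : ℝ) :
    (324 * z ^ 3 * I) * (fun s : ℂ => Gamma s ^ 4 * Gamma ((3 / 2 : ℝ) - s) *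
      (2 : ℂ) ^ (-(2 : ℂ) * s) * z ^ (-(3 : ℂ) * s)) (κ + t * I) =
    (108 * z ^ 3) * (MBmul κ (MBg κ) t * z ^ (-(3 : ℂ) * (κ + t * I))) +
    (162 * z ^ 3) * (MBg κ t * z ^ (-(3 : ℂ) * (κ + t * I))) := by
  simp only [MBmul, MBg]
  have hs0 : (1 / 2 - (κ + t * I) : ℂ) ≠ 0 := by
    intro h
    have := congrArg Complex.re h
    simp at this
    linarith
  generalize (κ + t * I : ℂ) = s at hs0
  rw [show ((3 / 2 : ℝ) : ℂ) - s = (1 / 2 - s) + 1 by push_cast; ring, Gamma_add_one _ hs0]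
  ring

/-- The Mellin–Barnes integral
`φ₂(z) = ∫_{Re s = κ} Γ(s)⁴ Γ(1/2 − s) 2^{−2s} z^{−3s} ds` (with `0 < κ < 1/2`, the line
oriented upward, `s = κ + it`, `ds = i dt`, and `z^{−3s}` the principal branch) is
holomorphic on the sector `−5π/6 < arg z < 5π/6` and satisfies
`D⁴φ₂ − 108 z³ Dφ₂ − 162 z³ φ₂ = 0` there, where `D = z d/dz`. -/
theorem MellinBarnes_solution_phi2 (κ : ℝ) (hκ0 : 0 < κ) (hκ : κ < 1 / 2) :
    let φ₂ : ℂ → ℂ := fun z =>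
      ∫ t : ℝ, (Complex.Gamma (κ + t * Complex.I)) ^ 4
        * Complex.Gamma (1 / 2 - (κ + t * Complex.I))
        * (2 : ℂ) ^ (-(2 : ℂ) * (κ + t * Complex.I))
        * z ^ (-(3 : ℂ) * (κ + t * Complex.I)) * Complex.I
    let S : Set ℂ := {z | z ≠ 0 ∧ |Complex.arg z| < 5 * Real.pi / 6}
    let D : (ℂ → ℂ) → (ℂ → ℂ) := fun f z => z * deriv f z
    DifferentiableOn ℂ φ₂ S ∧
      ∀ z ∈ S, D (D (D (D φ₂))) z - 108 * z ^ 3 * D φ₂ z - 162 * z ^ 3 * φ₂ z = 0 := by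
  intro φ₂ S D
  have hS : S = MBS := rfl
  have hφ : φ₂ = fun z : ℂ => ∫ t : ℝ, MBg κ t * z ^ (-(3 : ℂ) * (κ + t * I)) := by
    funext z
    show (∫ t : ℝ, _) = _
    congr 1
    ext t
    simp only [MBg]
    ring
  have d0 := MBg_decay κ hκ0 hκ
  have d1 := d0.mul κ
  have d2 := d1.mul κ
  have d3 := d2.mul κ
  have q0 : Set.EqOn φ₂ _ MBS := fun z _ => congrFun hφ z
  have q1 : Set.EqOn (D φ₂) _ MBS := fun z hz => mb_D d0 κ hz _ q0
  have q2 : Set.EqOn (D (D φ₂)) _ MBS := fun z hz => mb_D d1 κ hz _ q1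
  have q3 : Set.EqOn (D (D (D φ₂))) _ MBS := fun z hz => mb_D d2 κ hz _ q2
  have q4 : Set.EqOn (D (D (D (D φ₂)))) _ MBS := fun z hz => mb_D d3 κ hz _ q3
  rw [hS]
  refine ⟨?_, ?_⟩
  · rw [hφ]
    exact fun z hz => (mb_hasDeriv d0 κ hz).differentiableAt.differentiableWithinAt
  · intro z hz
    rw [q4 hz, q1 hz, q0 hz]
    simp only [mb_left κ hκ0 hz]
    rw [integral_const_mul, ← mb_main_shift κ hκ0 hκ hz, ← integral_const_mul]
    simp only [mb_right κ hκ]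
    rw [integral_add ((mb_integrable d1 κ hz).const_mul _) ((mb_integrable d0 κ hz).const_mul _),
      integral_const_mul, integral_const_mul]
    ring
end

section
/- With φ₁, φ₂ the Mellin–Barnes solutions defined by φ₁(z) = ∫ (Γ(s)⁴/Γ(s+1/2)) 2^{−2s} e^{πis} z^{−3s} ds (Re s = κ > 0) and φ₂(z) = ∫ Γ(s)⁴ Γ(1/2 − s) 2^{−2s} z^{−3s} ds (Re s = κ, 0 < κ < 1/2), the identity φ₂(z e^{−2πi/3}) = 2π φ₁(z) − φ₂(z) holds for −π/6 < arg z < π/2. -/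
open Complex MeasureTheory

lemma mb_rpow_int (σ c : ℝ) (hσ : -1 < σ) (hc : 0 < c) :
    Integrable (fun t : ℝ => t ^ σ * Real.exp (-(c * t))) (volume.restrict (Set.Ioi 0)) := by
  have := integrableOn_rpow_mul_exp_neg_mul_rpow (p := 1) hσ one_pos hc
  simpa [IntegrableOn] using this

lemma mb_cpow_norm_pos (s r : ℂ) (t : ℝ) (ht : 0 < t) :
    ‖(t:ℂ) ^ (s - 1) * cexp (-(r * t))‖ = t ^ (s.re - 1) * Real.exp (-(r.re * t)) := by
  rw [norm_mul, Complex.norm_cpow_eq_rpow_re_of_pos ht, Complex.norm_exp]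
  simp

lemma mb_meas (s r : ℂ) : AEStronglyMeasurable (fun t : ℝ => (t:ℂ) ^ (s - 1) * cexp (-(r * t)))
    (volume.restrict (Set.Ioi 0)) := by
  refine ContinuousOn.aestronglyMeasurable ?_ measurableSet_Ioi
  refine ContinuousOn.mul (fun t ht => ?_) (by fun_prop)
  exact (Complex.continuousAt_ofReal_cpow_const t (s - 1)
    (Or.inr (ne_of_gt ht))).continuousWithinAt

lemma mb_int_complex (s r : ℂ) (hs : 0 < s.re) (hr : 0 < r.re) :
    ∫ t : ℝ in Set.Ioi 0, (t:ℂ) ^ (s - 1) * cexp (-(r * t)) = (1 / r) ^ s * Complex.Gamma s := by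
  have hopen : IsOpen {r : ℂ | 0 < r.re} := isOpen_lt continuous_const Complex.continuous_re
  have hconv : Convex ℝ {r : ℂ | 0 < r.re} := convex_halfSpace_re_gt 0
  have hL : DifferentiableOn ℂ (fun r : ℂ => ∫ t : ℝ in Set.Ioi 0, (t:ℂ) ^ (s - 1) * cexp (-(r * t)))
      {r : ℂ | 0 < r.re} := by
    intro r₀ h0
    have h0' : 0 < r₀.re := h0
    have := hasDerivAt_integral_of_dominated_loc_of_deriv_le
      (μ := volume.restrict (Set.Ioi (0:ℝ)))
      (F := fun (r : ℂ) (t : ℝ) => (t:ℂ) ^ (s - 1) * cexp (-(r * t)))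
      (F' := fun (r : ℂ) (t : ℝ) => (t:ℂ) ^ (s - 1) * (cexp (-(r * t)) * (-t)))
      (x₀ := r₀) (s := {r : ℂ | r₀.re / 2 < r.re})
      (bound := fun t : ℝ => t ^ s.re * Real.exp (-(r₀.re / 2 * t)))
      ?_ ?_ ?_ ?_ ?_ ?_ ?_
    · exact this.2.differentiableAt.differentiableWithinAt
    · exact (isOpen_lt continuous_const Complex.continuous_re).mem_nhds
        (by show r₀.re / 2 < r₀.re; linarith)
    · exact Filter.Eventually.of_forall fun r => mb_meas s r
    · refine (mb_rpow_int (s.re - 1) r₀.re (by linarith) h0').mono' (mb_meas s r₀) ?_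
      filter_upwards [ae_restrict_mem measurableSet_Ioi] with t ht
      exact (mb_cpow_norm_pos s r₀ t ht).le
    · have := (mb_meas s r₀).mul
        (Continuous.aestronglyMeasurable (by fun_prop : Continuous fun t : ℝ => (-t : ℂ)))
      simpa only [Pi.mul_def, mul_assoc] using this
    · filter_upwards [ae_restrict_mem measurableSet_Ioi] with t ht r hr
      have ht' : 0 < t := ht
      have hr' : r₀.re / 2 < r.re := hr
      rw [← mul_assoc, norm_mul, mb_cpow_norm_pos s r t ht, norm_neg, Complex.norm_real,
        Real.norm_of_nonneg ht'.le, mul_right_comm, Real.rpow_sub_one ht'.ne',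
        div_mul_cancel₀ _ ht'.ne']
      gcongr
    · exact mb_rpow_int s.re _ (by linarith) (by linarith)
    · filter_upwards [ae_restrict_mem measurableSet_Ioi] with t ht r hr
      have h1 : HasDerivAt (fun r : ℂ => -(r * t)) (-(t:ℂ)) r := by
        have h := (hasDerivAt_id r).mul_const (-(t:ℂ))
        simp only [id, mul_neg, one_mul] at h
        exact h
      exact h1.cexp.const_mul _
  have hR : DifferentiableOn ℂ (fun r : ℂ => (1 / r) ^ s * Complex.Gamma s) {r : ℂ | 0 < r.re} := by
    intro r₀ h0
    have h0' : 0 < r₀.re := h0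
    have hne : r₀ ≠ 0 := by rintro rfl; simp at h0'
    refine DifferentiableAt.differentiableWithinAt ?_
    refine DifferentiableAt.mul_const (DifferentiableAt.cpow_const ?_ ?_) _
    · exact (differentiableAt_const _).div differentiableAt_id hne
    · refine Or.inl ?_
      rw [one_div, Complex.inv_re]
      exact div_pos h0' (Complex.normSq_pos.2 hne)
  refine (hL.analyticOnNhd hopen).eqOn_of_preconnected_of_frequently_eq (hR.analyticOnNhd hopen)
    hconv.isPreconnected (z₀ := 1) (by simp) ?_ hr
  have hfr : ∃ᶠ x : ℝ in nhdsWithin 1 {1}ᶜ, 0 < x :=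
    (Filter.Eventually.filter_mono nhdsWithin_le_nhds (lt_mem_nhds one_pos)).frequently
  have ht : Filter.Tendsto (fun x : ℝ => (x:ℂ)) (nhdsWithin 1 {1}ᶜ) (nhdsWithin 1 {1}ᶜ) := by
    refine tendsto_nhdsWithin_iff.2 ⟨?_, ?_⟩
    · have := (Complex.continuous_ofReal.tendsto 1).mono_left
        (nhdsWithin_le_nhds (s := ({1}ᶜ : Set ℝ)))
      simpa using this
    · filter_upwards [self_mem_nhdsWithin] with x hx
      simpa using hx
  refine ht.frequently (hfr.mono fun x hx => ?_)
  exact Complex.integral_cpow_mul_exp_neg_mul_Ioi hs hx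

lemma mb_gamma_le (β : ℝ) (h1 : -(Real.pi/2) < β) (h2 : β < Real.pi/2) (s : ℂ) (hs : 0 < s.re) :
    ‖Complex.Gamma s‖ * Real.exp (β * s.im) ≤ (1 / Real.cos β) ^ s.re * Real.Gamma s.re := by
  have hc : 0 < Real.cos β := Real.cos_pos_of_mem_Ioo ⟨h1, h2⟩
  have hre : (cexp (β * I)).re = Real.cos β := by rw [Complex.exp_ofReal_mul_I_re]
  have key := mb_int_complex s (cexp (β * I)) hs
    (by rw [hre]; exact hc)
  have hn : ‖(1 / cexp (β * I)) ^ s‖ = Real.exp (β * s.im) := by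
    have e : 1 / cexp (β * I) = cexp (-(β * I)) := by rw [Complex.exp_neg, one_div]
    rw [e, Complex.cpow_def_of_ne_zero (Complex.exp_ne_zero _), Complex.log_exp, Complex.norm_exp]
    · congr 1; simp
    · simp; linarith [Real.pi_pos]
    · simp; linarith [Real.pi_pos]
  rw [← Real.integral_rpow_mul_exp_neg_mul_Ioi hs hc, mul_comm, ← hn, ← norm_mul, ← key]
  refine (norm_integral_le_integral_norm _).trans (le_of_eq ?_)
  refine setIntegral_congr_fun measurableSet_Ioi fun t ht => ?_
  simp only [norm_mul]
  rw [Complex.norm_cpow_eq_rpow_re_of_pos ht, Complex.norm_exp]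
  congr 2
  simp only [neg_re, mul_re, ofReal_re, ofReal_im, hre]; ring

lemma mb_gamma_bound (α : ℝ) (h1 : 0 < α) (h2 : α < Real.pi/2) (a b : ℝ) (ha : 0 < a) :
    ∃ C : ℝ, 0 < C ∧ ∀ s : ℂ, a ≤ s.re → s.re ≤ b →
      ‖Complex.Gamma s‖ ≤ C * Real.exp (-(α * |s.im|)) := by
  have hc : 0 < Real.cos α := Real.cos_pos_of_mem_Ioo ⟨by linarith, h2⟩
  have hcont : ContinuousOn (fun x : ℝ => (1 / Real.cos α) ^ x * Real.Gamma x) (Set.Icc a b) := by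
    apply ContinuousOn.mul
    · exact (Real.continuous_const_rpow (by positivity)).continuousOn
    · intro x hx
      refine (Real.differentiableAt_Gamma ?_).continuousAt.continuousWithinAt
      intro m hm
      have : 0 < x := ha.trans_le hx.1
      have : (0:ℝ) ≤ m := Nat.cast_nonneg m
      linarith
  obtain ⟨C, hC⟩ := isCompact_Icc.exists_bound_of_continuousOn hcont
  refine ⟨max C 1, by positivity, fun s hs1 hs2 => ?_⟩
  have hb := (le_abs_self _).trans (hC s.re ⟨hs1, hs2⟩)
  have hle : ‖Complex.Gamma s‖ * Real.exp (α * |s.im|) ≤ max C 1 := by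
    refine le_trans ?_ (hb.trans (le_max_left _ _))
    rcases le_total 0 s.im with h | h
    · rw [abs_of_nonneg h]
      exact mb_gamma_le α (by linarith) h2 s (ha.trans_le hs1)
    · rw [abs_of_nonpos h]
      have := mb_gamma_le (-α) (by linarith) (by linarith) s (ha.trans_le hs1)
      rw [Real.cos_neg] at this
      rwa [mul_neg, ← neg_mul]
  rw [Real.exp_neg, ← div_eq_mul_inv, le_div_iff₀ (Real.exp_pos _)]
  exact hle

lemma mb_gamma_shift (n : ℕ) (v : ℂ) (hv : 1 ≤ |v.im|) :
    ‖Complex.Gamma v‖ ≤ ‖Complex.Gamma (v + n)‖ := by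
  induction n with
  | zero => simp
  | succ n ih =>
    refine ih.trans ?_
    have h1 : 1 ≤ ‖v + n‖ := by
      refine le_trans ?_ (Complex.abs_im_le_norm _)
      simpa using hv
    have h0 : v + n ≠ 0 := by
      intro h; rw [h] at h1; simp at h1; linarith
    have : v + ((n + 1 : ℕ) : ℂ) = (v + n) + 1 := by push_cast; ring
    rw [this, Complex.Gamma_add_one _ h0, norm_mul]
    exact le_mul_of_one_le_left (norm_nonneg _) h1

lemma mb_sin_bound (w : ℂ) : ‖Complex.sin w‖ ≤ Real.exp |w.im| := by
  rw [Complex.sin, norm_div, norm_mul, norm_I, mul_one]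
  have h := norm_sub_le (cexp (-w * I)) (cexp (w * I))
  have e1 : ‖cexp (-w * I)‖ ≤ Real.exp |w.im| := by
    rw [Complex.norm_exp]; apply Real.exp_le_exp.2; simpa using le_abs_self _
  have e2 : ‖cexp (w * I)‖ ≤ Real.exp |w.im| := by
    rw [Complex.norm_exp]; apply Real.exp_le_exp.2; simpa using neg_le_abs _
  rw [show ‖(2:ℂ)‖ = 2 by simp]
  linarith

lemma mb_gamma_inv_bound (α : ℝ) (h1 : 0 < α) (h2 : α < Real.pi/2) (a b : ℝ) :
    ∃ C : ℝ, 0 < C ∧ ∀ w : ℂ, a ≤ w.re → w.re ≤ b →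
      ‖(Complex.Gamma w)⁻¹‖ ≤ C * Real.exp ((Real.pi - α) * |w.im|) := by
  obtain ⟨n, hn⟩ := exists_nat_gt b
  obtain ⟨C, hC0, hC⟩ := mb_gamma_bound α h1 h2 (n + 1 - b) (n + 1 - a) (by linarith)
  have hcomp : IsCompact (Set.Icc a b ×ℂ Set.Icc (-1:ℝ) 1) :=
    isCompact_Icc.reProdIm isCompact_Icc
  obtain ⟨D, hD⟩ := hcomp.exists_bound_of_continuousOn
    (Complex.differentiable_one_div_Gamma.continuous.continuousOn)
  have hpi := Real.pi_gt_three
  refine ⟨max C D, by positivity, fun w hw1 hw2 => ?_⟩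
  rcases le_total 1 |w.im| with hw | hw
  · have hs := Complex.Gamma_mul_Gamma_one_sub w
    have hsin : Complex.sin (Real.pi * w) ≠ 0 := by
      intro h
      rw [Complex.sin_eq_zero_iff] at h
      obtain ⟨k, hk⟩ := h
      have hk2 : w = k := by
        have : (Real.pi : ℂ) ≠ 0 := by exact_mod_cast Real.pi_ne_zero
        apply mul_left_cancel₀ this; rw [hk]; ring
      rw [hk2] at hw; simp at hw; linarith
    have hG : Complex.Gamma w ≠ 0 := by
      intro h
      rw [h, zero_mul] at hs
      have : (Real.pi : ℂ) ≠ 0 := by exact_mod_cast Real.pi_ne_zero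
      exact (div_ne_zero this hsin) hs.symm
    have e : (Complex.Gamma w)⁻¹ = Complex.Gamma (1 - w) * Complex.sin (Real.pi * w) / Real.pi := by
      have hp : (Real.pi : ℂ) ≠ 0 := by exact_mod_cast Real.pi_ne_zero
      rw [eq_div_iff hsin] at hs
      rw [inv_eq_iff_eq_inv, inv_div, eq_div_iff]
      · linear_combination hs
      · intro h
        apply hp
        rw [← hs, mul_assoc, h, mul_zero]
    have b1 := (mb_gamma_shift n (1 - w) (by simpa using hw)).trans
      (hC (1 - w + n) (by simp; linarith) (by simp; linarith))
    have b2 := mb_sin_bound (Real.pi * w)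
    have i1 : |(1 - w + n).im| = |w.im| := by simp
    have i2 : |((Real.pi:ℂ) * w).im| = Real.pi * |w.im| := by
      simp [abs_mul, abs_of_pos Real.pi_pos]
    rw [i1] at b1
    rw [i2] at b2
    rw [e, norm_div, norm_mul]
    have hp : ‖(Real.pi:ℂ)‖ = Real.pi := by simp [abs_of_pos Real.pi_pos]
    rw [hp]
    calc _ ≤ ‖Complex.Gamma (1 - w)‖ * ‖Complex.sin (Real.pi * w)‖ :=
          div_le_self (by positivity) (by linarith)
      _ ≤ (C * Real.exp (-(α * |w.im|))) * Real.exp (Real.pi * |w.im|) := by gcongr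
      _ = C * Real.exp ((Real.pi - α) * |w.im|) := by
          rw [mul_assoc, ← Real.exp_add]; congr 2; ring
      _ ≤ _ := by gcongr; exact le_max_left _ _
  · have := hD w ⟨⟨hw1, hw2⟩, abs_le.1 hw⟩
    refine this.trans ((le_max_right C D).trans ?_)
    apply le_mul_of_one_le_right (by positivity)
    apply Real.one_le_exp
    apply mul_nonneg (by linarith) (abs_nonneg _)

lemma mb_integrable_exp (δ : ℝ) (hδ : 0 < δ) : Integrable fun t : ℝ => Real.exp (-(δ * |t|)) := by
  rw [← integrableOn_univ, ← Set.Iic_union_Ioi (a := (0:ℝ))]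
  refine IntegrableOn.union ?_ ?_
  · refine (integrableOn_exp_mul_Iic hδ 0).congr_fun (fun t ht => ?_) measurableSet_Iic
    simp only [abs_of_nonpos (Set.mem_Iic.1 ht)]; congr 1; ring
  · refine (integrableOn_exp_mul_Ioi (neg_lt_zero.2 hδ) 0).congr_fun (fun t ht => ?_)
      measurableSet_Ioi
    simp only [abs_of_pos (Set.mem_Ioi.1 ht)]; congr 1; ring

lemma mb_shift_s12 (F : ℂ → ℂ) (a b C δ : ℝ) (hab : a ≤ b) (hδ : 0 < δ)
    (hF : DifferentiableOn ℂ F {s | a ≤ s.re})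
    (hB : ∀ s : ℂ, a ≤ s.re → s.re ≤ b → ‖F s‖ ≤ C * Real.exp (-(δ * |s.im|))) :
    ∫ t : ℝ, F (a + t * I) = ∫ t : ℝ, F (b + t * I) := by
  have hint : ∀ x : ℝ, a ≤ x → x ≤ b → Integrable fun t : ℝ => F (x + t * I) := by
    intro x h1 h2
    refine ((mb_integrable_exp δ hδ).const_mul C).mono' ?_ ?_
    · apply Continuous.aestronglyMeasurable
      refine hF.continuousOn.comp_continuous (by fun_prop) (fun t => by simpa using h1)
    · refine Filter.Eventually.of_forall fun t => ?_
      simpa using hB (x + t * I) (by simpa using h1) (by simpa using h2)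
  have rect : ∀ T : ℝ, I * (∫ t in (-T)..T, F (b + t * I)) - I * (∫ t in (-T)..T, F (a + t * I))
      = (∫ x in a..b, F (x + T * I)) - ∫ x in a..b, F (x + (-T : ℝ) * I) := by
    intro T
    have := Complex.integral_boundary_rect_eq_zero_of_differentiableOn F
      (a + (-T : ℝ) * I) (b + T * I) (hF.mono ?_)
    · simp only [smul_eq_mul, add_re, add_im, mul_re, mul_im, ofReal_re, ofReal_im, I_re, I_im,
        mul_zero, mul_one, zero_add, add_zero, sub_zero, zero_mul] at this
      linear_combination this
    · intro s hs
      have := hs.1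
      simp [Set.uIcc_of_le hab] at this
      exact this.1
  have hh : ∀ ε : ℝ, |ε| = 1 → Filter.Tendsto (fun T : ℝ => ∫ x in a..b, F (x + (ε * T : ℝ) * I))
      Filter.atTop (nhds 0) := by
    intro ε hε
    have lim : Filter.Tendsto (fun T : ℝ => C * Real.exp (-(δ * |T|)) * |b - a|) Filter.atTop
        (nhds 0) := by
      have h1 : Filter.Tendsto (fun T : ℝ => Real.exp (-(δ * |T|))) Filter.atTop (nhds 0) :=
        Real.tendsto_exp_neg_atTop_nhds_zero.comp
          (Filter.tendsto_abs_atTop_atTop.const_mul_atTop hδ)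
      simpa using (h1.const_mul C).mul_const |b - a|
    refine squeeze_zero_norm (fun T => ?_) lim
    refine intervalIntegral.norm_integral_le_of_norm_le_const fun x hx => ?_
    rw [Set.uIoc_of_le hab] at hx
    have := hB (x + (ε * T : ℝ) * I) (by simpa using hx.1.le) (by simpa using hx.2)
    refine this.trans (le_of_eq ?_)
    congr 4
    have : ((x:ℂ) + (ε * T : ℝ) * I).im = ε * T := by simp
    rw [this, abs_mul, hε, one_mul]
  have l1 := intervalIntegral_tendsto_integral (hint a le_rfl hab) Filter.tendsto_neg_atTop_atBot
    Filter.tendsto_id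
  have l2 := intervalIntegral_tendsto_integral (hint b hab le_rfl) Filter.tendsto_neg_atTop_atBot
    Filter.tendsto_id
  have l3 := (l2.const_mul I).sub (l1.const_mul I)
  have l4 := (hh 1 (by simp)).sub (hh (-1) (by simp))
  simp only [one_mul, neg_one_mul, sub_zero] at l4
  have := tendsto_nhds_unique (l3.congr rect) l4
  rw [← mul_sub] at this
  have := (mul_eq_zero.1 this).resolve_left I_ne_zero
  exact (sub_eq_zero.1 this).symm

lemma mb_cpow_norm (z : ℂ) (hz : z ≠ 0) (s : ℂ) :
    ‖z ^ (-(3:ℂ) * s)‖ = Real.exp (-3 * Real.log ‖z‖ * s.re) * Real.exp (3 * arg z * s.im) := by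
  rw [Complex.cpow_def_of_ne_zero hz, Complex.norm_exp, ← Real.exp_add]
  congr 1
  simp [Complex.log_re, Complex.log_im]
  ring

lemma mb_two_norm (s : ℂ) :
    ‖(2:ℂ) ^ (-(2:ℂ) * s)‖ = Real.exp (-2 * Real.log 2 * s.re) := by
  have := Complex.norm_cpow_eq_rpow_re_of_pos (x := 2) (by norm_num) (-(2:ℂ) * s)
  push_cast at this
  rw [this, Real.rpow_def_of_pos (by norm_num)]
  congr 1; simp; ring

lemma mb_exp_re_bound (c a b : ℝ) : ∃ C : ℝ, 0 < C ∧ ∀ x, a ≤ x → x ≤ b →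
    Real.exp (c * x) ≤ C := by
  refine ⟨Real.exp (|c| * max |a| |b|), Real.exp_pos _, fun x h1 h2 => Real.exp_le_exp.2 ?_⟩
  refine (le_abs_self _).trans ?_
  rw [abs_mul]
  gcongr
  exact abs_le_max_abs_abs h1 h2

lemma mb_F1_bound (α : ℝ) (h1 : 0 < α) (h2 : α < Real.pi/2) (z : ℂ) (hz : z ≠ 0)
    (δ : ℝ) (hα : |3 * arg z - Real.pi| + δ ≤ 5 * α - Real.pi) (a b : ℝ) (ha : 0 < a) :
    ∃ C : ℝ, ∀ s : ℂ, a ≤ s.re → s.re ≤ b →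
      ‖Gamma s ^ 4 / Gamma (s + 1/2) * (2:ℂ) ^ (-(2:ℂ) * s) * cexp (Real.pi * I * s)
        * z ^ (-(3:ℂ) * s) * I‖ ≤ C * Real.exp (-(δ * |s.im|)) := by
  obtain ⟨C1, p1, H1⟩ := mb_gamma_bound α h1 h2 a b ha
  obtain ⟨C2, p2, H2⟩ := mb_gamma_inv_bound α h1 h2 (a + 1/2) (b + 1/2)
  obtain ⟨C3, p3, H3⟩ := mb_exp_re_bound (-2 * Real.log 2) a b
  obtain ⟨C4, p4, H4⟩ := mb_exp_re_bound (-3 * Real.log ‖z‖) a b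
  refine ⟨C1 ^ 4 * C2 * C3 * C4, fun s hs1 hs2 => ?_⟩
  have B1 := H1 s hs1 hs2
  have B2 := H2 (s + 1/2) (by simpa using hs1) (by simpa using hs2)
  have him : (s + 1/2).im = s.im := by simp
  rw [him] at B2
  have B5 : ‖cexp (Real.pi * I * s)‖ = Real.exp (-(Real.pi * s.im)) := by
    rw [Complex.norm_exp]; simp
  rw [div_eq_mul_inv, norm_mul, norm_mul, norm_mul, norm_mul, norm_mul, norm_pow, norm_I, mul_one,
    mb_two_norm, mb_cpow_norm z hz, B5]
  calc _ ≤ (C1 * Real.exp (-(α * |s.im|))) ^ 4 * (C2 * Real.exp ((Real.pi - α) * |s.im|)) * C3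
        * Real.exp (-(Real.pi * s.im)) * (C4 * Real.exp (3 * arg z * s.im)) := by
        gcongr
        · exact H3 _ hs1 hs2
        · exact H4 _ hs1 hs2
    _ = C1 ^ 4 * C2 * C3 * C4 * Real.exp (4 * -(α * |s.im|) + (Real.pi - α) * |s.im|
        + -(Real.pi * s.im) + 3 * arg z * s.im) := by
        rw [Real.exp_add, Real.exp_add, Real.exp_add, mul_pow, ← Real.exp_nat_mul]
        push_cast; ring
    _ ≤ _ := by
        gcongr
        have : (3 * arg z - Real.pi) * s.im ≤ |3 * arg z - Real.pi| * |s.im| := by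
          rw [← abs_mul]; exact le_abs_self _
        nlinarith [abs_nonneg s.im]

lemma mb_F2_integrable (α : ℝ) (h1 : 0 < α) (h2 : α < Real.pi/2) (z : ℂ) (hz : z ≠ 0)
    (hα : |3 * arg z| < 5 * α) (κ : ℝ) (h0 : 0 < κ) (hκ : κ < 1/2) :
    Integrable fun t : ℝ => (Complex.Gamma (κ + t * Complex.I)) ^ 4
        * Complex.Gamma (1 / 2 - (κ + t * Complex.I))
        * (2 : ℂ) ^ (-(2 : ℂ) * (κ + t * Complex.I))
        * z ^ (-(3 : ℂ) * (κ + t * Complex.I)) * Complex.I := by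
  obtain ⟨C1, p1, H1⟩ := mb_gamma_bound α h1 h2 κ κ h0
  obtain ⟨C2, p2, H2⟩ := mb_gamma_bound α h1 h2 (1/2 - κ) (1/2 - κ) (by linarith)
  have hGc : ∀ g : ℝ → ℂ, Continuous g → (∀ t, 0 < (g t).re) →
      Continuous fun t => Gamma (g t) := by
    intro g hg hp
    rw [continuous_iff_continuousAt]
    intro t
    refine ContinuousAt.comp (g := Gamma) (Complex.differentiableAt_Gamma _ ?_).continuousAt
      hg.continuousAt
    intro m hm
    have := hp t
    rw [hm] at this
    simp at this
    have h : (0:ℝ) ≤ m := Nat.cast_nonneg m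
    linarith
  have c1 := hGc (fun t : ℝ => κ + t * I) (by fun_prop) (by intro t; simpa using h0)
  have c2 := hGc (fun t : ℝ => 1/2 - (κ + t * I)) (by fun_prop) (by intro t; simpa using hκ)
  have c3 : ∀ w : ℂ, w ≠ 0 → ∀ c : ℂ, Continuous fun t : ℝ => w ^ (c * (κ + t * I)) := by
    intro w hw c
    exact Continuous.const_cpow (by fun_prop) (Or.inl hw)
  refine ((mb_integrable_exp (5 * α - |3 * arg z|) (by linarith)).const_mul
    (C1 ^ 4 * C2 * Real.exp (-2 * Real.log 2 * κ) * Real.exp (-3 * Real.log ‖z‖ * κ))).mono' ?_ ?_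
  · apply Continuous.aestronglyMeasurable
    exact ((((c1.pow 4).mul c2).mul (c3 2 two_ne_zero _)).mul (c3 z hz _)).mul continuous_const
  · refine Filter.Eventually.of_forall fun t => ?_
    have B1 := H1 (κ + t * I) (by simp) (by simp)
    have B2 := H2 (1/2 - (κ + t * I)) (by simp) (by simp)
    have i1 : ((κ:ℂ) + t * I).im = t := by simp
    have i2 : |(1/2 - ((κ:ℂ) + t * I)).im| = |t| := by simp
    have i3 : ((κ:ℂ) + t * I).re = κ := by simp
    rw [i1] at B1
    rw [i2] at B2
    rw [norm_mul, norm_mul, norm_mul, norm_mul, norm_pow, norm_I, mul_one,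
      mb_two_norm, mb_cpow_norm z hz, i1, i3]
    calc _ ≤ (C1 * Real.exp (-(α * |t|))) ^ 4 * (C2 * Real.exp (-(α * |t|)))
          * Real.exp (-2 * Real.log 2 * κ)
          * (Real.exp (-3 * Real.log ‖z‖ * κ) * Real.exp (3 * arg z * t)) := by
          gcongr
      _ = C1 ^ 4 * C2 * Real.exp (-2 * Real.log 2 * κ) * Real.exp (-3 * Real.log ‖z‖ * κ)
          * Real.exp (4 * -(α * |t|) + -(α * |t|) + 3 * arg z * t) := by
          rw [Real.exp_add, Real.exp_add, mul_pow, ← Real.exp_nat_mul]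
          push_cast; ring
      _ ≤ _ := by
          gcongr
          have : 3 * arg z * t ≤ |3 * arg z| * |t| := by
            rw [← abs_mul]; exact le_abs_self _
          nlinarith [abs_nonneg t]

lemma mb_F1_diff (z : ℂ) (hz : z ≠ 0) (a : ℝ) (ha : 0 < a) :
    DifferentiableOn ℂ (fun s : ℂ => Gamma s ^ 4 / Gamma (s + 1/2) * (2:ℂ) ^ (-(2:ℂ) * s)
      * cexp (Real.pi * I * s) * z ^ (-(3:ℂ) * s) * I) {s | a ≤ s.re} := by
  have g1 : DifferentiableOn ℂ Gamma {s | a ≤ s.re} := by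
    intro s hs
    refine (Complex.differentiableAt_Gamma _ ?_).differentiableWithinAt
    intro m hm
    have : a ≤ s.re := hs
    rw [hm] at this
    simp at this
    have h : (0:ℝ) ≤ m := Nat.cast_nonneg m
    linarith
  have g2 : Differentiable ℂ fun s : ℂ => (Gamma (s + 1/2))⁻¹ :=
    Complex.differentiable_one_div_Gamma.comp (by fun_prop : Differentiable ℂ fun s : ℂ => s + 1/2)
  have g3 : ∀ w : ℂ, w ≠ 0 → ∀ c : ℂ, Differentiable ℂ fun s : ℂ => w ^ (c * s) := by
    intro w hw c
    exact Differentiable.const_cpow (by fun_prop) (Or.inl hw)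
  have g4 : Differentiable ℂ fun s : ℂ => cexp (Real.pi * I * s) := by fun_prop
  simp only [div_eq_mul_inv] at *
  exact (((((g1.pow 4).mul g2.differentiableOn).mul (g3 2 two_ne_zero _).differentiableOn).mul
    g4.differentiableOn).mul (g3 z hz _).differentiableOn).mul_const I

lemma mb_reflect (s : ℂ) (h0 : 0 < s.re) (h1 : s.re < 1/2) :
    Gamma (1/2 - s) * (1 + cexp (2 * Real.pi * I * s))
      = 2 * Real.pi * cexp (Real.pi * I * s) / Gamma (s + 1/2) := by
  have hG : Gamma (s + 1/2) ≠ 0 := Complex.Gamma_ne_zero_of_re_pos (by simp; linarith)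
  have hG' : Gamma (1/2 - s) ≠ 0 := Complex.Gamma_ne_zero_of_re_pos (by simp; linarith)
  have h := Complex.Gamma_mul_Gamma_one_sub (s + 1/2)
  rw [show (1:ℂ) - (s + 1/2) = 1/2 - s by ring,
    show (Real.pi:ℂ) * (s + 1/2) = Real.pi * s + Real.pi / 2 by ring, Complex.sin_add_pi_div_two] at h
  have hp : (Real.pi : ℂ) ≠ 0 := by exact_mod_cast Real.pi_ne_zero
  have hcos : Complex.cos (Real.pi * s) ≠ 0 := by
    intro hc; rw [hc, div_zero] at h; exact mul_ne_zero hG hG' h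
  rw [eq_div_iff hG]
  have e : 1 + cexp (2 * Real.pi * I * s) = 2 * Complex.cos (Real.pi * s) * cexp (Real.pi * I * s) := by
    rw [Complex.cos]
    have : cexp (-(Real.pi * s) * I) * cexp (Real.pi * I * s) = 1 := by
      rw [← Complex.exp_add, ← Complex.exp_zero]; congr 1; ring
    have h2 : cexp (Real.pi * s * I) * cexp (Real.pi * I * s) = cexp (2 * Real.pi * I * s) := by
      rw [← Complex.exp_add]; congr 1; ring
    linear_combination -this - h2
  rw [e]
  rw [eq_div_iff hcos] at h
  linear_combination 2 * cexp (Real.pi * I * s) * h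

lemma mb_log (z : ℂ) (hz : z ≠ 0) (h1 : -Real.pi/6 < arg z) (h2 : arg z < Real.pi/2) :
    Complex.log (z * cexp (-(2 * Real.pi * I) / 3)) = Complex.log z + -(2 * Real.pi * I) / 3 := by
  have hp := Real.pi_pos
  have e : z * cexp (-(2 * Real.pi * I) / 3) = cexp (Complex.log z + -(2 * Real.pi * I) / 3) := by
    rw [Complex.exp_add, Complex.exp_log hz]
  have him : (Complex.log z + -(2 * Real.pi * I) / 3).im = arg z - 2 * Real.pi / 3 := by
    have : (-(2 * Real.pi * I) / 3 : ℂ) = ((-(2 * Real.pi) / 3 : ℝ) : ℂ) * I := by push_cast; ring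
    rw [this, Complex.add_im, Complex.log_im, Complex.im_ofReal_mul]
    simp; ring
  rw [e, Complex.log_exp]
  · rw [him]; linarith
  · rw [him]; linarith

/-- Connection identity between the two Mellin–Barnes solutions of the quantum
differential equation of `LG(2,4)`:
`φ₂(z e^{−2πi/3}) = 2π φ₁(z) − φ₂(z)` for `−π/6 < arg z < π/2`, where
`φ₁(z) = ∫_{Re s = κ₁} (Γ(s)⁴/Γ(s+1/2)) 2^{−2s} e^{πis} z^{−3s} ds` (`κ₁ > 0`) and
`φ₂(z) = ∫_{Re s = κ₂} Γ(s)⁴ Γ(1/2 − s) 2^{−2s} z^{−3s} ds` (`0 < κ₂ < 1/2`),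
both lines oriented upward and `z^{−3s}` the principal branch. -/
theorem MellinBarnes_connection_identity
    (κ₁ κ₂ : ℝ) (hκ₁ : 0 < κ₁) (hκ₂0 : 0 < κ₂) (hκ₂ : κ₂ < 1 / 2) :
    let φ₁ : ℂ → ℂ := fun z =>
      ∫ t : ℝ, (Complex.Gamma (κ₁ + t * Complex.I)) ^ 4
        / Complex.Gamma ((κ₁ + t * Complex.I) + 1 / 2)
        * (2 : ℂ) ^ (-(2 : ℂ) * (κ₁ + t * Complex.I))
        * Complex.exp (Real.pi * Complex.I * (κ₁ + t * Complex.I))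
        * z ^ (-(3 : ℂ) * (κ₁ + t * Complex.I)) * Complex.I
    let φ₂ : ℂ → ℂ := fun z =>
      ∫ t : ℝ, (Complex.Gamma (κ₂ + t * Complex.I)) ^ 4
        * Complex.Gamma (1 / 2 - (κ₂ + t * Complex.I))
        * (2 : ℂ) ^ (-(2 : ℂ) * (κ₂ + t * Complex.I))
        * z ^ (-(3 : ℂ) * (κ₂ + t * Complex.I)) * Complex.I
    ∀ z : ℂ, z ≠ 0 → -Real.pi / 6 < Complex.arg z → Complex.arg z < Real.pi / 2 →
      φ₂ (z * Complex.exp (-(2 * Real.pi * Complex.I) / 3))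
        = 2 * Real.pi * φ₁ z - φ₂ z := by
  intro φ₁ φ₂ z hz hz1 hz2
  have hp := Real.pi_pos
  have habs : |3 * arg z - Real.pi| < 3 * Real.pi / 2 := by rw [abs_lt]; constructor <;> linarith
  obtain ⟨δ, hδ, α, hα0, hα1, hα⟩ : ∃ δ : ℝ, 0 < δ ∧ ∃ α : ℝ, 0 < α ∧ α < Real.pi / 2 ∧
      |3 * arg z - Real.pi| + δ ≤ 5 * α - Real.pi := by
    refine ⟨(3 * Real.pi / 2 - |3 * arg z - Real.pi|) / 2, by linarith,
      (|3 * arg z - Real.pi| + (3 * Real.pi / 2 - |3 * arg z - Real.pi|) / 2 + Real.pi) / 5, ?_, ?_, ?_⟩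
    · have := abs_nonneg (3 * arg z - Real.pi); linarith
    · linarith
    · linarith
  have hlog := mb_log z hz hz1 hz2
  set z' := z * cexp (-(2 * Real.pi * I) / 3) with hz'
  have hz'0 : z' ≠ 0 := mul_ne_zero hz (Complex.exp_ne_zero _)
  have harg : arg z' = arg z - 2 * Real.pi / 3 := by
    have := congrArg Complex.im hlog
    have e : (-(2 * Real.pi * I) / 3 : ℂ) = ((-(2 * Real.pi) / 3 : ℝ) : ℂ) * I := by push_cast; ring
    rw [e, Complex.add_im, Complex.log_im, Complex.log_im, Complex.im_ofReal_mul] at this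
    rw [this]; simp; ring
  obtain ⟨ha1, ha2⟩ := abs_le.1 (show |3 * arg z - Real.pi| ≤ 5 * α - Real.pi - δ by linarith)
  have I1 := mb_F2_integrable α hα0 hα1 z hz
    (by rw [abs_lt]; constructor <;> linarith) κ₂ hκ₂0 hκ₂
  have I2 := mb_F2_integrable α hα0 hα1 z' hz'0
    (by rw [harg, abs_lt]; constructor <;> linarith) κ₂ hκ₂0 hκ₂
  have hshift : φ₁ z = ∫ t : ℝ, (fun s : ℂ => Gamma s ^ 4 / Gamma (s + 1/2) * (2:ℂ) ^ (-(2:ℂ) * s)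
      * cexp (Real.pi * I * s) * z ^ (-(3:ℂ) * s) * I) (κ₂ + t * I) := by
    rcases le_total κ₁ κ₂ with h | h
    · obtain ⟨C, hC⟩ := mb_F1_bound α hα0 hα1 z hz δ hα κ₁ κ₂ hκ₁
      exact mb_shift_s12 _ κ₁ κ₂ C δ h hδ (mb_F1_diff z hz κ₁ hκ₁) hC
    · obtain ⟨C, hC⟩ := mb_F1_bound α hα0 hα1 z hz δ hα κ₂ κ₁ hκ₂0
      exact (mb_shift_s12 _ κ₂ κ₁ C δ h hδ (mb_F1_diff z hz κ₂ hκ₂0) hC).symm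
  rw [eq_sub_iff_add_eq, hshift, ← integral_const_mul]
  simp only [φ₂]
  rw [← integral_add I2 I1]
  refine integral_congr_ae (Filter.Eventually.of_forall fun t => ?_)
  simp only []
  have hr := mb_reflect (κ₂ + t * I) (by simpa using hκ₂0) (by simpa using hκ₂)
  generalize (κ₂ + t * I : ℂ) = s at hr ⊢
  have hc : z' ^ (-(3:ℂ) * s) = z ^ (-(3:ℂ) * s) * cexp (2 * Real.pi * I * s) := by
    rw [Complex.cpow_def_of_ne_zero hz'0, Complex.cpow_def_of_ne_zero hz, hlog, ← Complex.exp_add]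
    congr 1; ring
  rw [hc]
  linear_combination (Gamma s ^ 4 * (2:ℂ) ^ (-(2:ℂ) * s) * z ^ (-(3:ℂ) * s) * I) * hr
end
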